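/- Fix integers 0 ≤ k ≤ n and set m = n − k. Let P = {p_1 < ⋯ < p_m} and Q = {q_1 < ⋯ < q_m} be index sets, and let λ and μ be the corresponding k-strict partitions, given by λ_j = n+k+1−p_j + #{i < j : p_i + p_j > 2n+1} and μ_j = n+k+1−q_j + #{i < j : q_i + q_j > 2n+1}. Then P → Q if and only if λ → μ. -/

import Mathlib

/-! Combinatorics of the Pieri rule for `IG(n-k,2n)`: index sets versus
`k`-strict partitions.  Partitions with at most `m` parts are represented as
weakly decreasing functions `Fin m → ℕ`; a box is a pair `(j, c)` consisting of
a (0-indexed) row `j : Fin m` and a (1-indexed) column `c : ℕ`. -/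

/-- Number of boxes in column `c` (`1`-indexed) of the partition `lam`. -/
def colCt {m : ℕ} (lam : Fin m → ℕ) (c : ℕ) : ℕ :=
  (Finset.univ.filter fun j : Fin m => c ≤ lam j).card

/-- The box `b = (row, col)` lies in the skew diagram `mu ∖ lam`. -/
def SkewBox {m : ℕ} (lam mu : Fin m → ℕ) (b : Fin m × ℕ) : Prop :=
  lam b.1 < b.2 ∧ b.2 ≤ mu b.1

/-- The boxes `b`, `b'` (with rows `0`-indexed and columns `1`-indexed) are
`k`-related: `|c−k−1| + r = |c'−k−1| + r'`. -/
def KRel (k : ℕ) {m : ℕ} (b b' : Fin m × ℕ) : Prop :=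
  |(b.2 : ℤ) - k - 1| + ((b.1 : ℕ) + 1) = |(b'.2 : ℤ) - k - 1| + ((b'.1 : ℕ) + 1)

/-- The Pieri relation `λ → μ` for `k`-strict partitions: `μ` is obtained from
`λ` by removing a vertical strip from the first `k` columns and adding a
horizontal strip to the result, subject to conditions (1) and (2) of
[Buch-Kresch-Tamvakis, Definition 1.3]. -/
def PieriArrow (k : ℕ) {m : ℕ} (lam mu : Fin m → ℕ) : Prop :=
  (∃ nu : Fin m → ℕ,
    (∀ i j : Fin m, i ≤ j → nu j ≤ nu i) ∧
    -- `λ ∖ ν` is a vertical strip contained in the first `k` columns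
    (∀ j, nu j ≤ lam j ∧ lam j ≤ nu j + 1) ∧
    (∀ j, nu j < lam j → lam j ≤ k) ∧
    -- `μ ∖ ν` is a horizontal strip
    (∀ j, nu j ≤ mu j) ∧
    (∀ i j : Fin m, (i : ℕ) + 1 = (j : ℕ) → mu j ≤ nu i)) ∧
  -- condition (1)
  (∀ c : ℕ, 1 ≤ c → c ≤ k → colCt mu c = colCt lam c →
    ∀ j : Fin m, (j : ℕ) + 1 = colCt mu c →
      {b : Fin m × ℕ | SkewBox lam mu b ∧ KRel k b (j, c)}.Subsingleton) ∧
  -- condition (2)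
  (∀ c : ℕ, 1 ≤ c → colCt mu c < colCt lam c →
    ∃ R : Fin m,
      (∀ j : Fin m, colCt mu c < (j : ℕ) + 1 → (j : ℕ) + 1 ≤ colCt lam c →
        (∃! b : Fin m × ℕ, SkewBox lam mu b ∧ KRel k b (j, c)) ∧
        (∀ b : Fin m × ℕ, SkewBox lam mu b → KRel k b (j, c) → b.1 = R)) ∧
      (∀ j : Fin m, (j : ℕ) + 1 = colCt mu c →
        (∃! b : Fin m × ℕ, SkewBox lam mu b ∧ KRel k b (j, c)) ∧
        (∀ b : Fin m × ℕ, SkewBox lam mu b → KRel k b (j, c) → b.1 = R)))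

/-- The Pieri relation `P → Q` on index sets for `IG(n-k,2n)`. -/
def IdxArrow (n : ℕ) {m : ℕ} (P Q : Fin m → ℕ) : Prop :=
  (∀ j, Q j ≤ P j) ∧
  (∀ i j : Fin m, (i : ℕ) + 1 = (j : ℕ) → P i ≤ Q j) ∧
  (∀ i j : Fin m, (i : ℕ) + 1 = (j : ℕ) → P i = Q j →
    ∃ l : Fin m, Q l < 2 * n + 1 - P i ∧ 2 * n + 1 - P i < P l)


/-- Number of entries of `p` strictly below `x`. -/
def cnt {m : ℕ} (p : Fin m → ℤ) (x : ℤ) : ℤ :=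
  ((Finset.univ.filter fun j : Fin m => p j < x).card : ℤ)

/-- Number of free values in `(n, x)`. -/
def frc {m : ℕ} (n : ℤ) (p : Fin m → ℤ) (x : ℤ) : ℤ :=
  x - n - 1 - cnt p x + cnt p (2 * n + 2 - x)

/-- Integer valued index sets. -/
structure IsIdx {m : ℕ} (n : ℤ) (p : Fin m → ℤ) : Prop where
  mono : StrictMono p
  one_le : ∀ j, 1 ≤ p j
  le_top : ∀ j, p j ≤ 2 * n
  ne : ∀ i j, p i + p j ≠ 2 * n + 1

lemma exists_row {m : ℕ} (s : ℤ) (h0 : 0 ≤ s) (h1 : s < m) : ∃ j : Fin m, ((j : ℕ) : ℤ) = s :=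
  ⟨⟨s.toNat, by omega⟩, by simp; omega⟩

lemma card_lt_fin {m : ℕ} (j : Fin m) :
    (Finset.univ.filter fun i : Fin m => i < j).card = (j : ℕ) := by
  have : (Finset.univ.filter fun i : Fin m => i < j) = Finset.Iio j := by
    ext; simp
  rw [this]; simp

lemma card_le_fin {m : ℕ} (j : Fin m) :
    (Finset.univ.filter fun i : Fin m => i ≤ j).card = (j : ℕ) + 1 := by
  have : (Finset.univ.filter fun i : Fin m => i ≤ j) = Finset.Iic j := by
    ext; simp
  rw [this]; simp

lemma cnt_nonneg {m : ℕ} (p : Fin m → ℤ) (x : ℤ) : 0 ≤ cnt p x := by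
  unfold cnt; positivity

lemma cnt_le {m : ℕ} (p : Fin m → ℤ) (x : ℤ) : cnt p x ≤ m := by
  unfold cnt
  have := Finset.card_filter_le (Finset.univ : Finset (Fin m)) (fun j => p j < x)
  simp at this
  exact_mod_cast this

/-- Generic: count of an initial segment predicate. -/
lemma card_iff {m : ℕ} (A : Fin m → Prop) [DecidablePred A]
    (hA : ∀ i j, i ≤ j → A j → A i) (j : Fin m) :
    A j ↔ (j : ℕ) < (Finset.univ.filter fun j : Fin m => A j).card := by
  constructor
  · intro h
    have h2 : (Finset.univ.filter fun i : Fin m => i ≤ j) ⊆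
        (Finset.univ.filter fun i : Fin m => A i) := by
      intro i hi
      simp only [Finset.mem_filter, Finset.mem_univ, true_and] at hi ⊢
      exact hA i j hi h
    have h3 := Finset.card_le_card h2
    rw [card_le_fin] at h3
    omega
  · intro h
    by_contra hc
    have h2 : (Finset.univ.filter fun i : Fin m => A i) ⊆
        (Finset.univ.filter fun i : Fin m => i < j) := by
      intro i hi
      simp only [Finset.mem_filter, Finset.mem_univ, true_and] at hi ⊢
      by_contra h3
      exact hc (hA j i (not_lt.mp h3) hi)
    have h3 := Finset.card_le_card h2
    rw [card_lt_fin] at h3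
    omega

lemma cnt_lt {m : ℕ} {p : Fin m → ℤ} (hp : StrictMono p) (j : Fin m) (x : ℤ) :
    p j < x ↔ ((j : ℕ) : ℤ) < cnt p x := by
  unfold cnt
  have := card_iff (fun j => p j < x) (fun i j hij h => lt_of_le_of_lt (hp.monotone hij) h) j
  rw [this]
  norm_cast

lemma cnt_self {m : ℕ} {p : Fin m → ℤ} (hp : StrictMono p) (j : Fin m) :
    cnt p (p j) = ((j : ℕ) : ℤ) := by
  have h1 := (cnt_lt hp j (p j)).not
  have h0 := cnt_nonneg p (p j)
  have h2 := cnt_le p (p j)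
  by_contra hne
  obtain ⟨i, hi⟩ := exists_row (m := m) (cnt p (p j)) h0 (by omega)
  have h3 := cnt_lt hp i (p j)
  have : i < j := by rw [Fin.lt_def]; omega
  have := hp this
  omega

lemma cnt_mono {m : ℕ} (p : Fin m → ℤ) {x y : ℤ} (h : x ≤ y) : cnt p x ≤ cnt p y := by
  unfold cnt
  norm_cast
  apply Finset.card_le_card
  intro i hi
  simp only [Finset.mem_filter, Finset.mem_univ, true_and] at hi ⊢
  omega

lemma cnt_succ_self {m : ℕ} {p : Fin m → ℤ} (hp : StrictMono p) (j : Fin m) :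
    cnt p (p j + 1) = ((j : ℕ) : ℤ) + 1 := by
  have h1 := (cnt_lt hp j (p j + 1)).mp (by omega)
  have h2 := cnt_le p (p j + 1)
  by_contra hne
  obtain ⟨i, hi⟩ := exists_row (m := m) ((j : ℕ) + 1) (by omega) (by omega)
  have h3 := cnt_lt hp i (p j + 1)
  have : j < i := by rw [Fin.lt_def]; omega
  have := hp this
  omega

lemma cnt_succ_of_not {m : ℕ} {p : Fin m → ℤ} {x : ℤ} (h : ∀ j, p j ≠ x) :
    cnt p (x + 1) = cnt p x := by
  unfold cnt
  congr 2
  ext i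
  have := h i
  simp only [Finset.mem_filter, Finset.mem_univ, true_and]
  omega

lemma cnt_step {m : ℕ} {p : Fin m → ℤ} (hp : StrictMono p) (x : ℤ) :
    (cnt p (x + 1) = cnt p x ∧ ∀ j, p j ≠ x) ∨ (cnt p (x + 1) = cnt p x + 1 ∧ ∃ j, p j = x) := by
  by_cases h : ∃ j, p j = x
  · right
    refine ⟨?_, h⟩
    obtain ⟨j, rfl⟩ := h
    rw [cnt_self hp, cnt_succ_self hp]
  · left
    push Not at h
    exact ⟨cnt_succ_of_not h, h⟩

lemma gap {m : ℕ} {p : Fin m → ℤ} (hp : StrictMono p) {i j : Fin m} (h : (i : ℕ) ≤ (j : ℕ)) :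
    p i - (i : ℕ) ≤ p j - (j : ℕ) := by
  obtain ⟨d, hd⟩ := Nat.exists_eq_add_of_le h
  induction d generalizing j with
  | zero =>
    have : i = j := by ext; omega
    subst this; omega
  | succ d ih =>
    have h1 := ih (j := ⟨(i : ℕ) + d, by omega⟩) (by simp) (by simp)
    have h2 : p ⟨(i : ℕ) + d, by omega⟩ < p j := hp (by rw [Fin.lt_def]; simp; omega)
    simp only at h1
    push_cast at h1
    omega

lemma frc_step {m : ℕ} {n : ℤ} {p : Fin m → ℤ} (hp : IsIdx n p) (x : ℤ) :
    (frc n p (x + 1) = frc n p x + 1 ∧ (∀ j, p j ≠ x) ∧ (∀ j, p j ≠ 2 * n + 1 - x)) ∨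
    frc n p (x + 1) = frc n p x := by
  unfold frc
  have h1 := cnt_step hp.mono x
  have h2 := cnt_step hp.mono (2 * n + 1 - x)
  rw [show 2 * n + 1 - x + 1 = 2 * n + 2 - x by ring] at h2
  rw [show 2 * n + 2 - (x + 1) = 2 * n + 1 - x by ring]
  rcases h1 with ⟨h1, h1'⟩ | ⟨h1, i, h1'⟩ <;> rcases h2 with ⟨h2, h2'⟩ | ⟨h2, j, h2'⟩
  · left; refine ⟨by omega, h1', h2'⟩
  · right; omega
  · right; omega
  · exact absurd (by omega) (hp.ne i j)

lemma frc_mono {m : ℕ} {n : ℤ} {p : Fin m → ℤ} (hp : IsIdx n p) {x y : ℤ} (h : x ≤ y) :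
    frc n p x ≤ frc n p y := by
  obtain ⟨d, rfl⟩ := Int.le.dest h
  induction d with
  | zero => simp
  | succ d ih =>
    have h1 := ih (by omega)
    have h2 := frc_step hp (x + d)
    push_cast
    rw [← add_assoc]
    omega

lemma frc_bot {m : ℕ} {n : ℤ} (p : Fin m → ℤ) : frc n p (n + 1) = 0 := by
  unfold frc
  rw [show 2 * n + 2 - (n + 1) = n + 1 by ring]; ring

lemma frc_top {m : ℕ} {n k : ℤ} {p : Fin m → ℤ} (hp : IsIdx n p) (hk : m + k = n) :
    frc n p (2 * n + 1) = k := by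
  unfold frc
  have h1 : cnt p (2 * n + 1) = m := by
    unfold cnt
    rw [Finset.filter_true_of_mem]
    · simp
    · intro j _; have := hp.le_top j; omega
  have h2 : cnt p (2 * n + 2 - (2 * n + 1)) = 0 := by
    unfold cnt
    rw [Finset.filter_false_of_mem]
    · simp
    · intro j _; have := hp.one_le j; omega
  rw [h1, h2]; omega

/-- `x` is the `t`-th free value. -/
structure IsFree {m : ℕ} (n : ℤ) (p : Fin m → ℤ) (t x : ℤ) : Prop where
  lo : n < x
  hi : x ≤ 2 * n
  f0 : frc n p x = t - 1
  f1 : frc n p (x + 1) = t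
  n1 : ∀ j, p j ≠ x
  n2 : ∀ j, p j ≠ 2 * n + 1 - x
  val : t + cnt p x = x - n + cnt p (2 * n + 1 - x)

lemma exists_free {m : ℕ} {n k : ℤ} {p : Fin m → ℤ} (hp : IsIdx n p) (hk : m + k = n)
    {t : ℤ} (h1 : 1 ≤ t) (h2 : t ≤ k) : ∃ x, IsFree n p t x := by
  have key : ∀ d : ℕ, frc n p (n + 1 + d) ≤ t - 1 ∨ ∃ x, n < x ∧ x < n + 1 + d ∧
      frc n p x = t - 1 ∧ frc n p (x + 1) = t := by
    intro d
    induction d with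
    | zero => left; simp [frc_bot]; omega
    | succ d ih =>
      rcases ih with ih | ⟨x, a, b, c⟩
      · have := frc_step hp (n + 1 + d)
        push_cast
        rw [← add_assoc]
        by_cases hh : frc n p (n + 1 + d + 1) ≤ t - 1
        · left; exact hh
        · right; exact ⟨n + 1 + d, by omega, by omega, by omega, by omega⟩
      · right; exact ⟨x, a, by push_cast; omega, c⟩
  have hn : 0 ≤ n := by omega
  rcases key n.toNat with h | ⟨x, a, b, c, d⟩
  · rw [show n + 1 + (n.toNat : ℤ) = 2 * n + 1 by omega, frc_top hp hk] at h
    omega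
  · rcases frc_step hp x with ⟨e, f, g⟩ | e
    · refine ⟨x, a, by omega, c, d, f, g, ?_⟩
      have h3 := cnt_succ_of_not g
      rw [show 2 * n + 1 - x + 1 = 2 * n + 2 - x by ring] at h3
      unfold frc at c
      omega
    · omega

/-- row `r` of the skew diagram contains a box of value `V` right of column `k`. -/
def Wd {m : ℕ} (n : ℤ) (p q : Fin m → ℤ) (r : Fin m) (V : ℤ) : Prop :=
  ((r : ℕ) : ℤ) + 1 ≤ V ∧ n + 1 - p r + (r : ℕ) < V ∧ V ≤ n + 1 - q r + (r : ℕ)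

def IsLam {m : ℕ} (n k : ℤ) (p : Fin m → ℤ) (lam : Fin m → ℕ) : Prop :=
  ∀ j, (p j ≤ n ∧ (lam j : ℤ) = n + k + 1 - p j) ∨ (n < p j ∧ (lam j : ℤ) = k - frc n p (p j))

lemma lam_le {m : ℕ} {n k : ℤ} {p : Fin m → ℤ} {lam : Fin m → ℕ} (hp : IsIdx n p)
    (hl : IsLam n k p lam) (j : Fin m) : p j ≤ n ∨ (lam j : ℤ) ≤ k := by
  rcases hl j with h | ⟨h1, h2⟩
  · exact Or.inl h.1
  · right
    have := frc_mono hp (show n + 1 ≤ p j by omega)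
    rw [frc_bot] at this
    omega

lemma lam_anti {m : ℕ} {n k : ℤ} {p : Fin m → ℤ} {lam : Fin m → ℕ} (hp : IsIdx n p)
    (hl : IsLam n k p lam) {i j : Fin m} (hij : i ≤ j) : lam j ≤ lam i := by
  have h0 := hp.mono.monotone hij
  have h1 := hl i
  have h2 := hl j
  have h3 := lam_le hp hl j
  have h4 := frc_mono hp h0
  omega

lemma isLam_of {m : ℕ} {n k : ℤ} {p : Fin m → ℤ} {lam : Fin m → ℕ} (hp : IsIdx n p)
    (h : ∀ j : Fin m, (lam j : ℤ) = n + k + 1 - p j +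
      ((Finset.univ.filter fun i : Fin m => i < j ∧ 2 * n + 1 < p i + p j).card : ℤ)) :
    IsLam n k p lam := by
  intro j
  rw [h j]
  by_cases hj : p j ≤ n
  · left
    refine ⟨hj, ?_⟩
    rw [Finset.filter_false_of_mem]
    · simp
    · rintro i - ⟨h1, h2⟩
      have := hp.mono h1
      omega
  · right
    refine ⟨by omega, ?_⟩
    unfold frc
    rw [cnt_self hp.mono]
    have h1 : (Finset.univ.filter fun i : Fin m => i < j ∧ 2 * n + 1 < p i + p j) =
        (Finset.univ.filter fun i : Fin m => i < j) \
        (Finset.univ.filter fun i : Fin m => p i < 2 * n + 2 - p j) := by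
      ext i
      simp only [Finset.mem_filter, Finset.mem_univ, true_and, Finset.mem_sdiff]
      constructor
      · rintro ⟨a, b⟩; exact ⟨a, by omega⟩
      · rintro ⟨a, b⟩; exact ⟨a, by omega⟩
    have h2 : (Finset.univ.filter fun i : Fin m => p i < 2 * n + 2 - p j) ⊆
        (Finset.univ.filter fun i : Fin m => i < j) := by
      intro i hi
      simp only [Finset.mem_filter, Finset.mem_univ, true_and] at hi ⊢
      by_contra hc
      have := hp.mono.monotone (not_lt.mp hc)
      omega
    have h3 := Finset.card_le_card h2
    rw [h1, Finset.card_sdiff_of_subset h2, Nat.cast_sub h3, card_lt_fin]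
    unfold cnt
    ring

lemma colCt_eq {m : ℕ} {n k : ℤ} {p : Fin m → ℤ} {lam : Fin m → ℕ} (hp : IsIdx n p)
    (hl : IsLam n k p lam) {t x : ℤ} (hx : IsFree n p t x) {c : ℕ} (hc : (c : ℤ) = k + 1 - t)
    (hck : (c : ℤ) ≤ k) :
    (colCt lam c : ℤ) = cnt p x := by
  unfold colCt cnt
  congr 2
  ext j
  simp only [Finset.mem_filter, Finset.mem_univ, true_and]
  have a0 := hx.lo
  have a1 := hx.f0
  have a2 := hx.f1
  have a3 := hx.n1 j
  rcases hl j with ⟨h1, h2⟩ | ⟨h1, h2⟩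
  · omega
  · constructor
    · intro h
      by_contra h4
      have := frc_mono hp (show x + 1 ≤ p j by omega)
      omega
    · intro h
      have := frc_mono hp h.le
      omega

lemma colCt_iff {m : ℕ} {lam : Fin m → ℕ} (hl : ∀ i j : Fin m, i ≤ j → lam j ≤ lam i)
    (j : Fin m) (c : ℕ) : c ≤ lam j ↔ (j : ℕ) < colCt lam c := by
  unfold colCt
  exact card_iff (fun j => c ≤ lam j) (fun i j hij h => h.trans (hl i j hij)) j

lemma frc_eq {m : ℕ} (n : ℤ) (p : Fin m → ℤ) (x : ℤ) :
    frc n p x = x - n - 1 - cnt p x + cnt p (2 * n + 2 - x) := rfl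

lemma box_iff {m : ℕ} {n : ℤ} {k : ℕ} {p q : Fin m → ℤ} {lam mu : Fin m → ℕ}
    (hp : IsIdx n p) (hq : IsIdx n q) (hl : IsLam n k p lam) (hm : IsLam n k q mu)
    {j : Fin m} {c : ℕ} (hck : c ≤ k) (hcl : c ≤ lam j)
    (hcm : ∀ r : Fin m, j < r → mu r < c) {V : ℤ} (hV : V = k + 1 - c + ((j : ℕ) + 1))
    (b : Fin m × ℕ) :
    SkewBox lam mu b ∧ KRel k b (j, c) ↔ Wd n p q b.1 V ∧ (b.2 : ℤ) = V - (b.1 : ℕ) + k := by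
  obtain ⟨r, d⟩ := b
  unfold SkewBox KRel Wd
  simp only
  have e1 : |(c : ℤ) - k - 1| = k + 1 - c := by
    rw [abs_of_nonpos] <;> omega
  rw [e1]
  have h1 := hl r
  have h2 := hm r
  have h3 := lam_le hp hl r
  have h4 := lam_le hq hm r
  by_cases hd : k + 1 ≤ d
  · have e2 : |(d : ℤ) - k - 1| = d - k - 1 := by
      rw [abs_of_nonneg]; omega
    rw [e2]
    omega
  · have e2 : |(d : ℤ) - k - 1| = k + 1 - d := by
      rw [abs_of_nonpos] <;> omega
    rw [e2]
    constructor
    · rintro ⟨⟨a1, a2⟩, a3⟩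
      exfalso
      by_cases hrj : r ≤ j
      · have := lam_anti hp hl hrj
        have : (r : ℕ) ≤ j := hrj
        omega
      · have h5 := hcm r (not_le.mp hrj)
        have : (j : ℕ) < r := not_le.mp hrj
        omega
    · rintro ⟨⟨a1, a2, a3⟩, a4⟩
      exfalso
      omega

structure Pieri' {m : ℕ} (n : ℤ) (k : ℕ) (p q : Fin m → ℤ) (lam mu : Fin m → ℕ) : Prop where
  A : ∀ j, lam j ≤ mu j + 1
  B : ∀ j, mu j < lam j → lam j ≤ k
  C : ∀ i j : Fin m, (i : ℕ) + 1 = (j : ℕ) → mu j ≤ lam i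
  one : ∀ t x x' : ℤ, 1 ≤ t → t ≤ k → IsFree n p t x → IsFree n q t x' → cnt p x = cnt q x' →
    1 ≤ cnt q x' → ∀ r r', Wd n p q r (t + cnt p x) → Wd n p q r' (t + cnt p x) → r = r'
  two : ∀ t x x' : ℤ, 1 ≤ t → t ≤ k → IsFree n p t x → IsFree n q t x' → cnt q x' < cnt p x →
    ∃ R : Fin m, ∀ V : ℤ, t + 1 ≤ V → t + cnt q x' ≤ V → V ≤ t + cnt p x →
      Wd n p q R V ∧ ∀ r, Wd n p q r V → r = R

lemma strip_iff {m : ℕ} {k : ℕ} {lam mu : Fin m → ℕ}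
    (hl : ∀ i j : Fin m, i ≤ j → lam j ≤ lam i) (hm : ∀ i j : Fin m, i ≤ j → mu j ≤ mu i) :
    (∃ nu : Fin m → ℕ,
    (∀ i j : Fin m, i ≤ j → nu j ≤ nu i) ∧
    (∀ j, nu j ≤ lam j ∧ lam j ≤ nu j + 1) ∧
    (∀ j, nu j < lam j → lam j ≤ k) ∧
    (∀ j, nu j ≤ mu j) ∧
    (∀ i j : Fin m, (i : ℕ) + 1 = (j : ℕ) → mu j ≤ nu i)) ↔
    (∀ j, lam j ≤ mu j + 1) ∧ (∀ j, mu j < lam j → lam j ≤ k) ∧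
    (∀ i j : Fin m, (i : ℕ) + 1 = (j : ℕ) → mu j ≤ lam i) := by
  constructor
  · rintro ⟨nu, h1, h2, h3, h4, h5⟩
    refine ⟨fun j => ?_, fun j hj => ?_, fun i j hij => ?_⟩
    · have := h2 j; have := h4 j; omega
    · have := h3 j; have := h4 j; omega
    · have := h2 i; have := h5 i j hij; omega
  · rintro ⟨h1, h2, h3⟩
    refine ⟨fun j => min (lam j) (mu j), fun i j hij => ?_, fun j => ?_, fun j hj => ?_,
      fun j => ?_, fun i j hij => ?_⟩
    · have := hl i j hij; have := hm i j hij; simp only; omega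
    · have := h1 j; simp only; omega
    · have := h2 j; simp only at hj; omega
    · simp only; omega
    · have := h3 i j hij
      have := hm i j (by rw [Fin.le_def]; omega)
      simp only; omega

lemma pieri_iff {m : ℕ} {n : ℤ} {k : ℕ} {p q : Fin m → ℤ} {lam mu : Fin m → ℕ}
    (hk : (m : ℤ) + k = n)
    (hp : IsIdx n p) (hq : IsIdx n q) (hl : IsLam n k p lam) (hm : IsLam n k q mu) :
    PieriArrow k lam mu ↔ Pieri' n k p q lam mu := by
  have la : ∀ i j : Fin m, i ≤ j → lam j ≤ lam i := fun i j h => lam_anti hp hl h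
  have ma : ∀ i j : Fin m, i ≤ j → mu j ≤ mu i := fun i j h => lam_anti hq hm h
  unfold PieriArrow
  rw [strip_iff la ma]
  -- boxes of a column between the two bottoms
  have box : ∀ (c : ℕ) (j : Fin m) (t : ℤ), (c : ℤ) = k + 1 - t → 1 ≤ t →
      colCt mu c ≤ (j : ℕ) + 1 → (j : ℕ) + 1 ≤ colCt lam c → ∀ b : Fin m × ℕ,
      (SkewBox lam mu b ∧ KRel k b (j, c) ↔
        Wd n p q b.1 (t + ((j : ℕ) + 1)) ∧
        (b.2 : ℤ) = (t + ((j : ℕ) + 1)) - (b.1 : ℕ) + k) := by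
    intro c j t hc ht h1 h2 b
    apply box_iff hp hq hl hm (by omega) ((colCt_iff la j c).mpr (by omega))
    · intro r hr
      have := (colCt_iff ma r c).not
      have : (j : ℕ) < r := hr
      omega
    · omega
  constructor
  · rintro ⟨⟨A, B, C⟩, h1, h2⟩
    refine ⟨A, B, C, ?_, ?_⟩
    · intro t x x' ht1 ht2 hx hx' he hpos r r' hr hr'
      obtain ⟨c, hc⟩ := Int.eq_ofNat_of_zero_le (show 0 ≤ (k : ℤ) + 1 - t by omega)
      have e1 := colCt_eq hp hl hx (c := c) (by omega) (by omega)
      have e2 := colCt_eq hq hm hx' (c := c) (by omega) (by omega)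
      have hle := cnt_le q x'
      obtain ⟨j, hj⟩ := exists_row (m := m) (cnt q x' - 1) (by omega) (by omega)
      have bx := box c j t (by omega) ht1 (by omega) (by omega)
      have h := h1 c (by omega) (by omega) (by omega) j (by omega)
      have hV : t + cnt p x = t + ((j : ℕ) + 1) := by omega
      rw [hV] at hr hr'
      have w1 := hr.1
      have w2 := hr'.1
      have g1 : SkewBox lam mu (r, (t + ((j : ℕ) + 1) - (r : ℕ) + k).toNat) ∧ KRel k _ (j, c) :=
        (bx _).mpr ⟨hr, by simp only; omega⟩
      have g2 : SkewBox lam mu (r', (t + ((j : ℕ) + 1) - (r' : ℕ) + k).toNat) ∧ KRel k _ (j, c) :=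
        (bx _).mpr ⟨hr', by simp only; omega⟩
      have := h g1 g2
      exact congrArg Prod.fst this
    · intro t x x' ht1 ht2 hx hx' he
      obtain ⟨c, hc⟩ := Int.eq_ofNat_of_zero_le (show 0 ≤ (k : ℤ) + 1 - t by omega)
      have e1 := colCt_eq hp hl hx (c := c) (by omega) (by omega)
      have e2 := colCt_eq hq hm hx' (c := c) (by omega) (by omega)
      have hle := cnt_le p x
      obtain ⟨R, hR1, hR2⟩ := h2 c (by omega) (by omega)
      refine ⟨R, fun V v1 v2 v3 => ?_⟩
      obtain ⟨j, hj⟩ := exists_row (m := m) (V - t - 1) (by omega) (by omega)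
      have bx := box c j t (by omega) ht1 (by omega) (by omega)
      have hV : V = t + ((j : ℕ) + 1) := by omega
      have hh : (∃! b : Fin m × ℕ, SkewBox lam mu b ∧ KRel k b (j, c)) ∧
        (∀ b : Fin m × ℕ, SkewBox lam mu b → KRel k b (j, c) → b.1 = R) := by
        by_cases hjj : (j : ℕ) + 1 = colCt mu c
        · exact hR2 j hjj
        · exact hR1 j (by omega) (by omega)
      rw [hV]
      obtain ⟨⟨b, hb, -⟩, hu⟩ := hh
      constructor
      · rw [← hu b hb.1 hb.2]
        exact ((bx b).mp hb).1
      · intro r hr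
        have w1 := hr.1
        have := (bx (r, (t + ((j : ℕ) + 1) - (r : ℕ) + k).toNat)).mpr
          ⟨hr, by simp only; omega⟩
        exact hu _ this.1 this.2
  · rintro ⟨A, B, C, h1, h2⟩
    refine ⟨⟨A, B, C⟩, ?_, ?_⟩
    · intro c c1 ck he j hj
      obtain ⟨x, hx⟩ := exists_free hp hk (t := k + 1 - c) (by omega) (by omega)
      obtain ⟨x', hx'⟩ := exists_free hq hk (t := k + 1 - c) (by omega) (by omega)
      have e1 := colCt_eq hp hl hx (c := c) (by omega) (by omega)
      have e2 := colCt_eq hq hm hx' (c := c) (by omega) (by omega)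
      have bx := box c j (k + 1 - c) (by omega) (by omega) (by omega) (by omega)
      have h := h1 _ x x' (by omega) (by omega) hx hx' (by omega) (by omega)
      have hV : (k : ℤ) + 1 - c + cnt p x = k + 1 - c + ((j : ℕ) + 1) := by omega
      rw [hV] at h
      rintro ⟨r, d⟩ hb ⟨r', d'⟩ hb'
      obtain ⟨g1, g2⟩ := (bx _).mp hb
      obtain ⟨g3, g4⟩ := (bx _).mp hb'
      have := h _ _ g1 g3
      simp only at this g2 g4
      subst this
      congr 1
      omega
    · intro c c1 he
      have ck : c ≤ k := by
        obtain ⟨j, hj⟩ := exists_row (m := m) (colCt mu c) (by omega) (by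
          have : colCt lam c ≤ m := by
            unfold colCt
            exact (Finset.card_filter_le _ _).trans (by simp)
          omega)
        have a1 := colCt_iff la j c
        have a2 := colCt_iff ma j c
        have := B j
        omega
      obtain ⟨x, hx⟩ := exists_free hp hk (t := k + 1 - c) (by omega) (by omega)
      obtain ⟨x', hx'⟩ := exists_free hq hk (t := k + 1 - c) (by omega) (by omega)
      have e1 := colCt_eq hp hl hx (c := c) (by omega) (by omega)
      have e2 := colCt_eq hq hm hx' (c := c) (by omega) (by omega)
      obtain ⟨R, hR⟩ := h2 _ x x' (by omega) (by omega) hx hx' (by omega)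
      have key : ∀ j : Fin m, colCt mu c ≤ (j : ℕ) + 1 → (j : ℕ) + 1 ≤ colCt lam c →
        (∃! b : Fin m × ℕ, SkewBox lam mu b ∧ KRel k b (j, c)) ∧
        (∀ b : Fin m × ℕ, SkewBox lam mu b → KRel k b (j, c) → b.1 = R) := by
        intro j j1 j2
        have bx := box c j (k + 1 - c) (by omega) (by omega) (by omega) (by omega)
        obtain ⟨g1, g2⟩ := hR (k + 1 - c + ((j : ℕ) + 1)) (by omega) (by omega) (by omega)
        have g0 := g1.1
        refine ⟨⟨(R, ((k : ℤ) + 1 - c + ((j : ℕ) + 1) - (R : ℕ) + k).toNat),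
          (bx _).mpr ⟨g1, by simp only; omega⟩, ?_⟩, ?_⟩
        · rintro ⟨r, d⟩ hb
          obtain ⟨g3, g4⟩ := (bx _).mp hb
          have := g2 _ g3
          simp only at this g4
          subst this
          congr 1
          omega
        · intro b b1 b2
          exact g2 _ ((bx b).mp ⟨b1, b2⟩).1
      exact ⟨R, fun j j1 j2 => key j (by omega) j2, fun j j1 => key j (by omega) (by omega)⟩

structure Idx' {m : ℕ} (n : ℤ) (p q : Fin m → ℤ) : Prop where
  le : ∀ j, q j ≤ p j
  inter : ∀ i j : Fin m, (i : ℕ) + 1 = (j : ℕ) → p i ≤ q j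
  touch : ∀ i j : Fin m, (i : ℕ) + 1 = (j : ℕ) → p i = q j →
    ∃ l : Fin m, q l < 2 * n + 1 - p i ∧ 2 * n + 1 - p i < p l

/-- interlacing below `B` gives interlacing of counts below `B`. -/
lemma cnt_inter {m : ℕ} {p q : Fin m → ℤ} (hp : StrictMono p) (hq : StrictMono q) (B : ℤ)
    (h1 : ∀ j, p j < B → q j ≤ p j)
    (h2 : ∀ i j : Fin m, (i : ℕ) + 1 = (j : ℕ) → q j < B → p i ≤ q j) (x : ℤ) (hx : x ≤ B) :
    cnt p x ≤ cnt q x ∧ cnt q x ≤ cnt p x + 1 := by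
  have a1 := cnt_nonneg p x
  have a2 := cnt_nonneg q x
  have a3 := cnt_le p x
  have a4 := cnt_le q x
  constructor
  · by_contra hc
    obtain ⟨j, hj⟩ := exists_row (m := m) (cnt q x) (by omega) (by omega)
    have b1 := cnt_lt hp j x
    have b2 := cnt_lt hq j x
    have := h1 j
    omega
  · by_contra hc
    obtain ⟨j, hj⟩ := exists_row (m := m) (cnt q x - 1) (by omega) (by omega)
    obtain ⟨i, hi⟩ := exists_row (m := m) (cnt q x - 2) (by omega) (by omega)
    have b1 := cnt_lt hp i x
    have b2 := cnt_lt hq j x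
    have := h2 i j (by omega)
    omega

lemma idx_to_pieri {m : ℕ} {n : ℤ} {k : ℕ} {p q : Fin m → ℤ} {lam mu : Fin m → ℕ}
    (hp : IsIdx n p) (hq : IsIdx n q) (hl : IsLam n k p lam) (hm : IsLam n k q mu)
    (h : Idx' n p q) : Pieri' n k p q lam mu := by
  have ci : ∀ x, cnt p x ≤ cnt q x ∧ cnt q x ≤ cnt p x + 1 := fun x =>
    cnt_inter hp.mono hq.mono x (fun j _ => h.le j) (fun i j hij _ => h.inter i j hij) x le_rfl
  refine ⟨?_, ?_, ?_, ?_, ?_⟩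
  · intro j
    have h0 := h.le j
    have h1 := hl j
    have h2 := hm j
    have h3 := lam_le hp hl j
    have h4 := frc_mono hq h0
    have h5 := ci (p j)
    have h6 := ci (2 * n + 2 - p j)
    have h7 := frc_eq n p (p j)
    have h8 := frc_eq n q (p j)
    omega
  · intro j hj
    have h0 := h.le j
    have h1 := hl j
    have h2 := hm j
    have h3 := lam_le hp hl j
    omega
  · intro i j hij
    have h0 := h.inter i j hij
    have h1 := hl i
    have h2 := hm j
    have h3 := lam_le hq hm j
    by_cases hn : p i ≤ n
    · omega
    suffices frc n p (p i) ≤ frc n q (q j) by omega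
    rcases eq_or_lt_of_le h0 with he | hlt
    · obtain ⟨l, l1, l2⟩ := h.touch i j hij he
      unfold frc
      rw [cnt_self hp.mono, cnt_self hq.mono, ← he]
      have a1 := cnt_lt hq.mono l (2 * n + 2 - p i)
      have a2 := cnt_lt hp.mono l (2 * n + 2 - p i)
      omega
    · have a1 := frc_mono hq (show p i + 1 ≤ q j by omega)
      have a2 := frc_mono hp (show p i ≤ p i + 1 by omega)
      have a3 := cnt_succ_self hp.mono i
      have a4 := (cnt_lt hq.mono j (p i + 1)).not
      have a5 := ci (2 * n + 2 - (p i + 1))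
      have h7 := frc_eq n p (p i + 1)
      have h8 := frc_eq n q (p i + 1)
      omega
  · intro t x x' ht1 ht2 hx hx' he hpos
    have key : ∀ r r' : Fin m, r < r' → Wd n p q r (t + cnt p x) →
        Wd n p q r' (t + cnt p x) → False := by
      intro r r' hrr hr hr'
      have hrr' : (r : ℕ) < r' := hrr
      have hv := hx.val
      rw [hv] at hr hr'
      obtain ⟨u1, u2, u3⟩ := hr
      obtain ⟨v1, v2, v3⟩ := hr'
      have s0 := cnt_nonneg p (2 * n + 1 - x)
      -- r ≥ s
      have hrs : cnt p (2 * n + 1 - x) ≤ (r : ℕ) := by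
        by_contra hc
        have := cnt_le p (2 * n + 1 - x)
        obtain ⟨i, hi⟩ := exists_row (m := m) (cnt p (2 * n + 1 - x) - 1) (by omega) (by omega)
        have b1 := cnt_lt hp.mono i (2 * n + 1 - x)
        have b2 := gap hp.mono (i := r) (j := i) (by omega)
        omega
      obtain ⟨i, hi⟩ := exists_row (m := m) (cnt p (2 * n + 1 - x)) (by omega) (by omega)
      obtain ⟨j, hj⟩ := exists_row (m := m) (cnt p (2 * n + 1 - x) + 1) (by omega) (by omega)
      have b1 := cnt_lt hp.mono i (2 * n + 1 - x)
      have b2 := gap hq.mono (i := j) (j := r') (by omega)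
      have b3 := hx.n2 i
      have b4 := h.inter i j (by omega)
      obtain ⟨l, l1, l2⟩ := h.touch i j (by omega) (by omega)
      have c1 := cnt_lt hq.mono l x
      have c2 := cnt_lt hp.mono l x
      have c3 := hx.n1 l
      have c4 := ci (2 * n + 2 - x)
      have c5 := hx.f0
      have c6 := hx'.f1
      have c7 := frc_eq n q x
      have c9 := frc_eq n p x
      have c8 : x < x' + 1 := by
        by_contra hc
        have := frc_mono hq (not_lt.mp hc)
        omega
      have := cnt_mono q (show x ≤ x' by omega)
      omega
    intro r r' hr hr'
    rcases lt_trichotomy r r' with hh | hh | hh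
    · exact (key r r' hh hr hr').elim
    · exact hh
    · exact (key r' r hh hr' hr).elim
  · intro t x x' ht1 ht2 hx hx' he
    have hxx : x' < x := by
      by_contra hc
      have := cnt_mono q (not_lt.mp hc)
      have := ci x
      omega
    have hv := hx.val
    have hv' := hx'.val
    have hlo' := hx'.lo
    have band : ∀ w, 2 * n + 1 - x ≤ w → w < 2 * n + 1 - x' →
        cnt q (w + 1) = cnt p (w + 1) + 1 ∧ cnt p (2 * n + 1 - w) = cnt q (2 * n + 1 - w) := by
      intro w w1 w2
      have a1 := frc_mono hq (show x' + 1 ≤ 2 * n + 1 - w by omega)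
      have a2 := frc_mono hp (show 2 * n + 1 - w ≤ x by omega)
      rw [hx'.f1] at a1
      rw [hx.f0] at a2
      unfold frc at a1 a2
      rw [show 2 * n + 2 - (2 * n + 1 - w) = w + 1 by ring] at a1 a2
      have a3 := ci (w + 1)
      have a4 := ci (2 * n + 1 - w)
      omega
    set y := 2 * n + 1 - x with hy
    set z := 2 * n + 1 - x' with hz
    have hy1 : cnt p (y + 1) = cnt p y := cnt_succ_of_not hx.n2
    have b0 := band y le_rfl (by omega)
    have b1 := cnt_nonneg p y
    have b2 := cnt_le q (y + 1)
    obtain ⟨i, hi⟩ := exists_row (m := m) (cnt p y) (by omega) (by omega)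
    have b3 := cnt_lt hq.mono i (y + 1)
    have b4 := cnt_lt hp.mono i (y + 1)
    have hpz : z ≤ p i := by
      by_contra hc
      have c0 := band (p i) (by omega) (by omega)
      rw [cnt_succ_self hp.mono] at c0
      have c1 := cnt_le q (p i + 1)
      obtain ⟨j, hj⟩ := exists_row (m := m) ((i : ℕ) + 1) (by omega) (by omega)
      have c2 := cnt_lt hq.mono j (p i + 1)
      have c3 := h.inter i j (by omega)
      obtain ⟨l, l1, l2⟩ := h.touch i j (by omega) (by omega)
      have c4 := cnt_lt hq.mono l (2 * n + 1 - p i)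
      have c5 := cnt_lt hp.mono l (2 * n + 1 - p i)
      omega
    have hcz : cnt q z = (i : ℕ) + 1 := by
      have d1 := (cnt_lt hq.mono i z).mp (by omega)
      by_contra hc
      have := cnt_le q z
      obtain ⟨j, hj⟩ := exists_row (m := m) ((i : ℕ) + 1) (by omega) (by omega)
      have c2 := cnt_lt hq.mono j z
      have c3 := h.inter i j (by omega)
      omega
    refine ⟨i, fun V v1 v2 v3 => ⟨⟨by omega, by omega, by omega⟩, ?_⟩⟩
    rintro r ⟨r1, r2, r3⟩
    have hzq := hx'.n2
    have hyp := hx.n2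
    by_contra hne
    have hne' : (r : ℕ) ≠ i := fun hh => hne (Fin.ext hh)
    rcases lt_or_gt_of_ne hne' with hlt | hgt
    · obtain ⟨j, hj⟩ := exists_row (m := m) ((i : ℕ) - 1) (by omega) (by omega)
      have e1 := gap hp.mono (i := r) (j := j) (by omega)
      have e2 := h.inter j i (by omega)
      have e3 := hyp j
      omega
    · obtain ⟨j, hj⟩ := exists_row (m := m) ((i : ℕ) + 1) (by omega) (by omega)
      have e1 := gap hq.mono (i := j) (j := r) (by omega)
      have e2 := h.inter i j (by omega)
      have e3 := hzq j
      omega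

lemma removed_col {m : ℕ} {n : ℤ} {k : ℕ} {p q : Fin m → ℤ} {lam mu : Fin m → ℕ}
    (hp : IsIdx n p) (hq : IsIdx n q) (h : Pieri' n k p q lam mu) {t x x' : ℤ}
    (ht1 : 1 ≤ t) (ht2 : t ≤ k) (hx : IsFree n p t x) (hx' : IsFree n q t x')
    (he : cnt q x' < cnt p x) :
    ∃ R : Fin m, q R ≤ 2 * n + 1 - x ∧ 2 * n + 1 - x' ≤ p R := by
  obtain ⟨R, hR⟩ := h.two t x x' ht1 ht2 hx hx' he
  have hv := hx.val
  have hv' := hx'.val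
  have hlo := hx.lo
  have hlo' := hx'.lo
  have hcq := cnt_nonneg q x'
  obtain ⟨⟨a1, a2, a3⟩, a4⟩ := hR (t + cnt p x) (by omega) (by omega) le_rfl
  have hzq := hx'.n2
  have hyp := hx.n2
  set y := 2 * n + 1 - x with hy
  set z := 2 * n + 1 - x' with hz
  have s0 := cnt_nonneg p y
  have hs1 := cnt_le p y
  have hRs : cnt p y ≤ (R : ℕ) := by
    by_contra hc
    obtain ⟨i, hi⟩ := exists_row (m := m) (cnt p y - 1) (by omega) (by omega)
    have b1 := cnt_lt hp.mono i y
    have b2 := gap hp.mono (i := R) (j := i) (by omega)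
    omega
  obtain ⟨i, hi⟩ := exists_row (m := m) (cnt p y) (by omega) (by omega)
  have b1 := cnt_lt hp.mono i y
  have b2 := hyp i
  have b3 := gap hq.mono (i := i) (j := R) (by omega)
  have b4 := a4 i ⟨by omega, by omega, by omega⟩
  subst b4
  refine ⟨i, by omega, ?_⟩
  have c1 := (cnt_lt hq.mono i x').mp (by omega)
  obtain ⟨⟨d1, d2, d3⟩, d4⟩ := hR (t + cnt q x') (by omega) (by omega) (by omega)
  have s2 := cnt_nonneg q z
  have s3 := cnt_le q z
  have e1 : (i : ℕ) < cnt q z := by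
    by_contra hc
    obtain ⟨j, hj⟩ := exists_row (m := m) (cnt q z) (by omega) (by omega)
    have f1 := cnt_lt hq.mono j z
    have f2 := hzq j
    have f3 := gap hq.mono (i := j) (j := i) (by omega)
    omega
  obtain ⟨j, hj⟩ := exists_row (m := m) (cnt q z - 1) (by omega) (by omega)
  have f1 := cnt_lt hq.mono j z
  have f3 := gap hp.mono (i := i) (j := j) (by omega)
  have f4 := d4 j ⟨by omega, by omega, by omega⟩
  subst f4
  omega

lemma pieri_to_idx {m : ℕ} {n : ℤ} {k : ℕ} {p q : Fin m → ℤ} {lam mu : Fin m → ℕ}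
    (hk : (m : ℤ) + k = n)
    (hp : IsIdx n p) (hq : IsIdx n q) (hl : IsLam n k p lam) (hm : IsLam n k q mu)
    (h : Pieri' n k p q lam mu) : Idx' n p q := by
  have le1 : ∀ j, p j < n + 1 → q j ≤ p j := by
    intro j hj
    have h1 := hl j
    have h2 := hm j
    have h3 := lam_le hq hm j
    have h4 := h.B j
    omega
  have in1 : ∀ i j : Fin m, (i : ℕ) + 1 = (j : ℕ) → q j < n + 1 → p i ≤ q j := by
    intro i j hij hj
    have h1 := hl i
    have h2 := hm j
    have h3 := lam_le hp hl i
    have h4 := h.C i j hij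
    omega
  have ci1 := cnt_inter hp.mono hq.mono (n + 1) le1 in1
  have ftop := fun x (hx : x ≤ 2 * n + 1) => (frc_mono hq hx).trans_eq (frc_top hq hk)
  have fbot := fun x (hx : n + 1 ≤ x) => (frc_bot (n := n) p).symm.trans_le (frc_mono hp hx)
  have le2 : ∀ j, q j ≤ p j := by
    intro j
    by_contra hc
    have hpn : n < p j := by
      by_contra hh
      have := le1 j (by omega)
      omega
    have h1 := hl j
    have h2 := hm j
    have h3 := h.A j
    have a1 := frc_mono hq (show p j + 1 ≤ q j by omega)
    have a2 := frc_mono hp (show p j ≤ p j + 1 by omega)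
    have a3 := cnt_succ_self hp.mono j
    have a4 := (cnt_lt hq.mono j (p j + 1)).not
    have a5 := ci1 (2 * n + 2 - (p j + 1)) (by omega)
    have a6 := frc_eq n p (p j + 1)
    have a7 := frc_eq n q (p j + 1)
    have a8 := ftop (q j) (by have := hq.le_top j; omega)
    have a9 := fbot (p j) (by omega)
    have t1 : 1 ≤ frc n q (q j) := by omega
    obtain ⟨x, hx⟩ := exists_free hp hk t1 a8
    obtain ⟨x', hx'⟩ := exists_free hq hk t1 a8
    have b1 : x' < p j + 1 := by
      by_contra hh
      have := frc_mono hq (not_lt.mp hh)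
      have := hx'.f0
      omega
    have b2 : p j + 1 < x + 1 := by
      by_contra hh
      have := frc_mono hp (not_lt.mp hh)
      have := hx.f1
      omega
    have b3 := cnt_mono q b1.le
    have b4 := cnt_mono p (show p j + 1 ≤ x by omega)
    obtain ⟨R, r1, r2⟩ := removed_col hp hq h t1 a8 hx hx' (by omega)
    have c1 := cnt_lt hq.mono R (2 * n + 2 - (p j + 1))
    have c2 := cnt_lt hp.mono R (2 * n + 2 - (p j + 1))
    omega
  have in2 : ∀ i j : Fin m, (i : ℕ) + 1 = (j : ℕ) → p i ≤ q j := by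
    intro i j hij
    by_contra hc
    have hqn : n < q j := by
      by_contra hh
      have := in1 i j hij (by omega)
      omega
    have h1 := hl i
    have h2 := hm j
    have h3 := h.C i j hij
    have a1 := frc_mono hp (show q j + 1 ≤ p i by omega)
    have a2 := frc_mono hq (show q j ≤ q j + 1 by omega)
    have a3 := cnt_succ_self hq.mono j
    have a4 := (cnt_lt hp.mono i (q j + 1)).not
    have a5 := ci1 (2 * n + 2 - (q j + 1)) (by omega)
    have a6 := frc_eq n p (q j + 1)
    have a7 := frc_eq n q (q j + 1)
    omega
  refine ⟨le2, in2, ?_⟩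
  have ci : ∀ x, cnt p x ≤ cnt q x ∧ cnt q x ≤ cnt p x + 1 := fun x =>
    cnt_inter hp.mono hq.mono x (fun j _ => le2 j) (fun i j hij _ => in2 i j hij) x le_rfl
  intro i j hij he
  by_cases hpn : n < p i
  · have h1 := hl i
    have h2 := hm j
    have h3 := h.C i j hij
    have a1 : frc n p (p i) ≤ frc n q (q j) := by omega
    unfold frc at a1
    rw [cnt_self hp.mono, cnt_self hq.mono, ← he] at a1
    have a2 := cnt_nonneg p (2 * n + 2 - p i)
    have a3 := cnt_le q (2 * n + 2 - p i)
    obtain ⟨l, hl'⟩ := exists_row (m := m) (cnt p (2 * n + 2 - p i)) (by omega) (by omega)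
    have b1 := cnt_lt hp.mono l (2 * n + 2 - p i)
    have b2 := cnt_lt hq.mono l (2 * n + 2 - p i)
    have b3 := hq.ne l j
    exact ⟨l, by omega, by omega⟩
  · by_contra hno
    have hcu : cnt p (2 * n + 1 - p i) = cnt q (2 * n + 1 - p i) := by
      have c0 := ci (2 * n + 1 - p i)
      by_contra hne
      have c1 := cnt_nonneg p (2 * n + 1 - p i)
      have c2 := cnt_le q (2 * n + 1 - p i)
      obtain ⟨l, hl'⟩ := exists_row (m := m) (cnt p (2 * n + 1 - p i)) (by omega) (by omega)
      have b1 := cnt_lt hp.mono l (2 * n + 1 - p i)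
      have b2 := cnt_lt hq.mono l (2 * n + 1 - p i)
      have b3 := hp.ne l i
      exact hno ⟨l, by omega, by omega⟩
    have p1 := cnt_succ_self hp.mono i
    have q1 := cnt_succ_self hq.mono j
    have p0 := cnt_self hp.mono i
    have q0 := cnt_self hq.mono j
    rw [← he] at q1 q0
    have pu : cnt p (2 * n + 1 - p i + 1) = cnt p (2 * n + 1 - p i) :=
      cnt_succ_of_not (fun l => by have := hp.ne l i; omega)
    have f1 := frc_eq n p (2 * n + 1 - p i)
    have f2 := frc_eq n q (2 * n + 1 - p i)
    have f3 := frc_eq n p (2 * n + 1 - p i + 1)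
    rw [show 2 * n + 2 - (2 * n + 1 - p i) = p i + 1 by ring] at f1 f2
    rw [show 2 * n + 2 - (2 * n + 1 - p i + 1) = p i by ring] at f3
    have pl := hp.one_le i
    have a8 := ftop (2 * n + 1 - p i) (by omega)
    have a9 := fbot (2 * n + 1 - p i) (by omega)
    have t1 : 1 ≤ frc n q (2 * n + 1 - p i) := by omega
    obtain ⟨x, hx⟩ := exists_free hp hk t1 a8
    obtain ⟨x', hx'⟩ := exists_free hq hk t1 a8
    have b1 : x' < 2 * n + 1 - p i := by
      by_contra hh
      have := frc_mono hq (not_lt.mp hh)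
      have := hx'.f0
      omega
    have b2 : 2 * n + 1 - p i + 1 < x + 1 := by
      by_contra hh
      have := frc_mono hp (not_lt.mp hh)
      have := hx.f1
      omega
    have b3 := cnt_mono q b1.le
    have b4 := cnt_mono p (show 2 * n + 1 - p i ≤ x by omega)
    rcases lt_or_ge (cnt q x') (cnt p x) with hlt | hge
    · obtain ⟨R, r1, r2⟩ := removed_col hp hq h t1 a8 hx hx' hlt
      have c1 := cnt_lt hq.mono R (p i)
      have c2 := cnt_lt hp.mono R (p i + 1)
      omega
    · have hqj := (cnt_lt hq.mono j x').mp (by have := hx'.lo; omega)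
      have d1 : q i < q j := hq.mono (by rw [Fin.lt_def]; omega)
      have d2 : p i < p j := hp.mono (by rw [Fin.lt_def]; omega)
      have := h.one _ x x' t1 a8 hx hx' (by omega) (by omega) i j
        ⟨by omega, by omega, by omega⟩ ⟨by omega, by omega, by omega⟩
      subst this
      omega

/-- **The Pieri relations agree.**  Let `P` and `Q` be index sets for
`IG(n−k,2n)` and `λ`, `μ` the corresponding `k`-strict partitions.  Then
`P → Q` if and only if `λ → μ`. -/
theorem idxArrow_iff_pieriArrow (n m k : ℕ) (hmk : m + k = n)
    (P Q : Fin m → ℕ)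
    (hPmono : StrictMono P) (hPrange : ∀ j, 1 ≤ P j ∧ P j ≤ 2 * n)
    (hPidx : ∀ i j, P i + P j ≠ 2 * n + 1)
    (hQmono : StrictMono Q) (hQrange : ∀ j, 1 ≤ Q j ∧ Q j ≤ 2 * n)
    (hQidx : ∀ i j, Q i + Q j ≠ 2 * n + 1)
    (lam mu : Fin m → ℕ)
    (hlam : ∀ j : Fin m, (lam j : ℤ) = (n + k + 1 : ℤ) - P j +
      ((Finset.univ.filter fun i : Fin m => i < j ∧ 2 * n + 1 < P i + P j).card : ℤ))
    (hmu : ∀ j : Fin m, (mu j : ℤ) = (n + k + 1 : ℤ) - Q j +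
      ((Finset.univ.filter fun i : Fin m => i < j ∧ 2 * n + 1 < Q i + Q j).card : ℤ)) :
    IdxArrow n P Q ↔ PieriArrow k lam mu := by
  have hp : IsIdx (n : ℤ) (fun j => (P j : ℤ)) :=
    ⟨fun i j hij => by have := hPmono hij; omega,
      fun j => by have := hPrange j; omega, fun j => by have := hPrange j; omega,
      fun i j => by have := hPidx i j; omega⟩
  have hq : IsIdx (n : ℤ) (fun j => (Q j : ℤ)) :=
    ⟨fun i j hij => by have := hQmono hij; omega,
      fun j => by have := hQrange j; omega, fun j => by have := hQrange j; omega,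
      fun i j => by have := hQidx i j; omega⟩
  have hl : IsLam (n : ℤ) k (fun j => (P j : ℤ)) lam := by
    apply isLam_of hp
    intro j
    rw [hlam j]
    norm_cast
  have hm : IsLam (n : ℤ) k (fun j => (Q j : ℤ)) mu := by
    apply isLam_of hq
    intro j
    rw [hmu j]
    norm_cast
  have hk : (m : ℤ) + k = n := by omega
  rw [pieri_iff hk hp hq hl hm]
  have e : IdxArrow n P Q ↔ Idx' (n : ℤ) (fun j => (P j : ℤ)) (fun j => (Q j : ℤ)) := by
    constructor
    · rintro ⟨h1, h2, h3⟩
      refine ⟨fun j => ?_, fun i j hij => ?_, fun i j hij he => ?_⟩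
      · have := h1 j; omega
      · have := h2 i j hij; omega
      · obtain ⟨l, l1, l2⟩ := h3 i j hij (by omega)
        have := hPrange i
        exact ⟨l, by omega, by omega⟩
    · rintro ⟨h1, h2, h3⟩
      refine ⟨fun j => ?_, fun i j hij => ?_, fun i j hij he => ?_⟩
      · have := h1 j; omega
      · have := h2 i j hij; omega
      · obtain ⟨l, l1, l2⟩ := h3 i j hij (by omega)
        have := hPrange i
        exact ⟨l, by omega, by omega⟩
  rw [e]
  exact ⟨idx_to_pieri hp hq hl hm, pieri_to_idx hk hp hq hl hm⟩
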